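/- For all x, y ∈ ℤ_{-τ}, the number τ²·(x·y) belongs to ℤ_{-τ}; that is, the product of any two (-τ)-integers has at most two fractional digits in its (-τ)-expansion (L_⊗(-τ) ≤ 2). -/

import Mathlib

/-- The Ito–Sadahiro transformation `T_{-β}` on `[l_β, r_β)`, where
`l_β = -β/(β+1)` and `r_β = 1/(β+1)`. -/
noncomputable def negT (β : ℝ) (x : ℝ) : ℝ :=
  -β * x - (⌊-β * x - (-β / (β + 1))⌋ : ℝ)

/-- `Fin(-β)`: reals `x` such that `(-β)^k * x ∈ (l_β, r_β)` for some `k : ℤ`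
and some iterate of `T_{-β}` sends it to `0`. -/
def negFin (β : ℝ) (x : ℝ) : Prop :=
  ∃ (k : ℤ) (n : ℕ), ((-β) ^ k * x ∈ Set.Ioo (-β / (β + 1)) (1 / (β + 1))) ∧
    (negT β)^[n] ((-β) ^ k * x) = 0

/-- The set `ℤ_{-β}` of `(-β)`-integers. -/
def negInt (β : ℝ) (x : ℝ) : Prop :=
  x = 0 ∨ ∃ (N : ℕ) (y : ℝ), y ∈ Set.Ioo (-β / (β + 1)) (1 / (β + 1)) ∧
    x = (-β) ^ (N + 1) * y ∧ (negT β)^[N + 1] y = 0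

/-- The `(-β)`-digit `d_{i+1}(y)` of `y ∈ [l_β, r_β)` (indices shifted so that
`negDigit β y i` is the digit `d_{i+1}(y)`). -/
noncomputable def negDigit (β : ℝ) (y : ℝ) (i : ℕ) : ℤ :=
  ⌊-β * ((negT β)^[i] y) - (-β / (β + 1))⌋

/-- The golden ratio `τ = (1+√5)/2`. -/
noncomputable def tau : ℝ := (1 + Real.sqrt 5) / 2

/-- The Rényi transformation `T_β` on `[0,1)`. -/
noncomputable def renyiT (β : ℝ) (x : ℝ) : ℝ := β * x - (⌊β * x⌋ : ℝ)

/-- The set `ℤ_β` of (nonnegative) `β`-integers. -/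
def posInt (β : ℝ) (x : ℝ) : Prop :=
  x = 0 ∨ ∃ N : ℕ, (β ^ (-(N + 1 : ℤ)) * x ∈ Set.Ico (0 : ℝ) 1) ∧
    (renyiT β)^[N + 1] (β ^ (-(N + 1 : ℤ)) * x) = 0

theorem tau_sq : tau ^ 2 = tau + 1 := by
  have h : Real.sqrt 5 ^ 2 = 5 := Real.sq_sqrt (by norm_num)
  unfold tau
  linear_combination h / 4

theorem tau_gt : 1.618 < tau := by
  have h : (2.236 : ℝ) < Real.sqrt 5 := Real.lt_sqrt_of_sq_lt (by norm_num)
  unfold tau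
  linarith

theorem tau_lt : tau < 1.6181 := by
  have h : Real.sqrt 5 < 2.2362 := (Real.sqrt_lt' (by norm_num)).2 (by norm_num)
  unfold tau
  linarith

theorem neg_tau_div : -tau / (tau + 1) = 1 - tau := by
  rw [div_eq_iff (by linarith [tau_gt])]
  linear_combination tau_sq

theorem one_div_tau_add_one : 1 / (tau + 1) = 2 - tau := by
  rw [div_eq_iff (by linarith [tau_gt])]
  linear_combination tau_sq

/-- One step of `T_{-τ}` on `[l_τ, r_τ)` subtracts a digit `0` or `1`, and the digit is `1`
whenever the image is the left end point. -/
theorem negT_tau_step {w : ℝ} (hw : w ∈ Set.Ico (1 - tau) (2 - tau)) :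
    ∃ d : ℤ, 0 ≤ d ∧ d ≤ 1 ∧ negT tau w = -tau * w - d ∧
      negT tau w ∈ Set.Ico (1 - tau) (2 - tau) ∧ (negT tau w = 1 - tau → 1 ≤ d) := by
  obtain ⟨h₁, h₂⟩ := hw
  have hs := tau_sq
  have hg := tau_gt
  have hl := tau_lt
  have hu : -tau * w ≤ 1 := by nlinarith
  have hv : 1 - tau < -tau * w := by nlinarith
  have hf := Int.floor_le (-tau * w - (1 - tau))
  have hf' := Int.lt_floor_add_one (-tau * w - (1 - tau))
  refine ⟨⌊-tau * w - (1 - tau)⌋, Int.floor_nonneg.2 (by linarith), ?_, ?_, ?_, ?_⟩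
  · refine Int.lt_add_one_iff.1 (Int.floor_lt.2 ?_)
    push_cast
    linarith
  · rw [negT, neg_tau_div]
  · rw [negT, neg_tau_div]
    exact ⟨by linarith, by linarith⟩
  · rw [negT, neg_tau_div]
    intro h
    have hpos : (0 : ℝ) < ⌊-tau * w - (1 - tau)⌋ := by linarith
    exact_mod_cast hpos

/-- The integer part `a + b τ` after `n` steps of `T_{-τ}` has its Galois conjugate
`a + b (1 - τ)` in `[0, τ²)`. -/
theorem negT_tau_iterate {y : ℝ} (hy : y ∈ Set.Ico (1 - tau) (2 - tau)) (n : ℕ) :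
    ∃ a b : ℤ, (-tau) ^ n * y = a + b * tau + (negT tau)^[n] y ∧
      0 ≤ a + b * (1 - tau) ∧ a + b * (1 - tau) < tau ^ 2 ∧
      (negT tau)^[n] y ∈ Set.Ico (1 - tau) (2 - tau) ∧
      (n ≠ 0 → (negT tau)^[n] y = 1 - tau → 1 ≤ a + b * (1 - tau)) := by
  have hs := tau_sq
  have hg := tau_gt
  have hl := tau_lt
  induction n with
  | zero => exact ⟨0, 0, by simp, by simp, by simp; positivity, by simpa using hy, by simp⟩
  | succ n ih =>
    obtain ⟨a, b, h, h0, h1, hI, -⟩ := ih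
    obtain ⟨d, hd0, hd1, hT, hTI, hTd⟩ := negT_tau_step hI
    have hd0' : (0 : ℝ) ≤ d := by exact_mod_cast hd0
    have hd1' : (d : ℝ) ≤ 1 := by exact_mod_cast hd1
    have hconj : ((d - b : ℤ) : ℝ) + ((-a - b : ℤ) : ℝ) * (1 - tau)
        = (a + b * (1 - tau)) * (tau - 1) + d := by
      push_cast
      linear_combination (b : ℝ) * hs
    have hnn : 0 ≤ (a + b * (1 - tau)) * (tau - 1) := mul_nonneg h0 (by linarith)
    rw [Function.iterate_succ_apply']
    refine ⟨d - b, -a - b, ?_, ?_, ?_, hTI, fun _ he => ?_⟩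
    · rw [hT, pow_succ]
      push_cast
      linear_combination -tau * h - (b : ℝ) * hs
    · rw [hconj]
      linarith
    · rw [hconj]
      nlinarith
    · rw [hconj]
      have : (1 : ℝ) ≤ d := by exact_mod_cast hTd he
      linarith

/-- The `(-τ)`-integers are the elements of `ℤ[τ]` with Galois conjugate in `[0, τ²)`. -/
theorem negInt_tau_iff (x : ℝ) :
    negInt tau x ↔ ∃ a b : ℤ, x = a + b * tau ∧
      0 ≤ a + b * (1 - tau) ∧ a + b * (1 - tau) < tau ^ 2 := by
  have hs := tau_sq
  have hg := tau_gt
  have hl := tau_lt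
  rw [negInt, neg_tau_div, one_div_tau_add_one]
  constructor
  · rintro (rfl | ⟨N, y, hy, rfl, hT⟩)
    · exact ⟨0, 0, by simp, by simp, by simp; positivity⟩
    · obtain ⟨a, b, h, h0, h1, -⟩ := negT_tau_iterate (Set.Ioo_subset_Ico_self hy) (N + 1)
      exact ⟨a, b, by rw [h, hT, add_zero], h0, h1⟩
  · rintro ⟨a, b, hx, h0, h1⟩
    obtain ⟨N, hN⟩ := pow_unbounded_of_one_lt (|x| / (2 - tau)) (show 1 < tau by linarith)
    rw [div_lt_iff₀ (by linarith)] at hN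
    have hpow : 0 < tau ^ (N + 1) := by positivity
    have hne : (-tau) ^ (N + 1) ≠ 0 := pow_ne_zero _ (by linarith)
    have hy : |x / (-tau) ^ (N + 1)| < 2 - tau := by
      rw [abs_div, abs_pow, abs_neg, abs_of_pos (show 0 < tau by linarith), div_lt_iff₀ hpow]
      have : tau ^ N ≤ tau ^ (N + 1) := pow_le_pow_right₀ (by linarith) (by omega)
      nlinarith
    obtain ⟨hy1, hy2⟩ := abs_lt.1 hy
    have hyI : x / (-tau) ^ (N + 1) ∈ Set.Ioo (1 - tau) (2 - tau) := ⟨by linarith, hy2⟩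
    refine Or.inr ⟨N, x / (-tau) ^ (N + 1), hyI, by field_simp, ?_⟩
    obtain ⟨c, d, h, hc0, hc1, ⟨hz1, hz2⟩, hend⟩ :=
      negT_tau_iterate (Set.Ioo_subset_Ico_self hyI) (N + 1)
    set z := (negT tau)^[N + 1] (x / (-tau) ^ (N + 1))
    rw [mul_div_cancel₀ _ hne, hx] at h
    obtain ⟨p, rfl⟩ : ∃ p, a = c + p := ⟨a - c, by ring⟩
    obtain ⟨q, rfl⟩ : ∃ q, b = d + q := ⟨b - d, by ring⟩
    push_cast at h h0 h1
    have hz : z = p + q * tau := by linarith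
    have hq1 : q < 2 := by
      by_contra! hq
      have : (2 : ℝ) ≤ q := by exact_mod_cast hq
      nlinarith
    have hq2 : -2 < q := by
      by_contra! hq
      have : (q : ℝ) ≤ -2 := by exact_mod_cast hq
      nlinarith
    have hp1 : p < 2 := by
      have : (p : ℝ) < 2 := by
        have : (-1 : ℝ) ≤ q := by exact_mod_cast (show -1 ≤ q by omega)
        nlinarith
      exact_mod_cast this
    have hp2 : -3 < p := by
      have : (-3 : ℝ) < p := by
        have : (q : ℝ) ≤ 1 := by exact_mod_cast (show q ≤ 1 by omega)
        nlinarith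
      exact_mod_cast this
    have hcases : z = 0 ∨ (p = 1 ∧ q = -1) := by
      interval_cases q <;> interval_cases p <;> norm_num at hz h0 h1 ⊢ <;> linarith
    rcases hcases with hz0 | ⟨rfl, rfl⟩
    · exact hz0
    · have := hend (by omega) (by rw [hz]; push_cast; ring)
      push_cast at h0 h1
      linarith

/-- For all `x, y ∈ ℤ_{-τ}`, `τ² (x·y) ∈ ℤ_{-τ}`, i.e. `L_⊗(-τ) ≤ 2`. -/
theorem L_otimes_neg_tau_le_two
    (x y : ℝ) (hx : negInt tau x) (hy : negInt tau y) :
    negInt tau (tau ^ 2 * (x * y)) := by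
  obtain ⟨a, b, rfl, ha0, ha1⟩ := (negInt_tau_iff x).1 hx
  obtain ⟨c, d, rfl, hc0, hc1⟩ := (negInt_tau_iff y).1 hy
  have hs := tau_sq
  have hg := tau_gt
  rw [negInt_tau_iff]
  -- with `p + q τ` the product, `τ² (p + q τ) = (p + q) + (p + 2 q) τ`
  have hconj : ((a * c + b * d + (a * d + b * c + b * d) : ℤ) : ℝ)
      + ((a * c + b * d + 2 * (a * d + b * c + b * d) : ℤ) : ℝ) * (1 - tau)
      = (2 - tau) * ((a + b * (1 - tau)) * (c + d * (1 - tau))) := by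
    push_cast
    linear_combination
      -((a * d + b * c + b * d : ℝ) + (2 - tau) * (b * d)) * hs
  have hnn := mul_nonneg ha0 hc0
  have hlt := mul_lt_mul'' ha1 hc1 ha0 hc0
  refine ⟨_, _, ?_, hconj.symm.le.trans' ?_, hconj.trans_lt ?_⟩
  · push_cast
    linear_combination ((a * c + b * d : ℝ) + (a * d + b * c + b * d) * tau
      + (a * d + b * c + b * d) + tau ^ 2 * (b * d)) * hs
  · exact mul_nonneg (by linarith [tau_lt]) hnn
  · have := mul_lt_mul_of_pos_left hlt (show 0 < 2 - tau by linarith [tau_lt])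
    have htau : (2 - tau) * (tau ^ 2 * tau ^ 2) = tau ^ 2 := by
      linear_combination (-tau ^ 3 + tau ^ 2) * hs
    linarith
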